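/- Let Σ be a closed subset of ℝ^n, let f₁, …, f_J : Σ → Σ be globally Lipschitz maps, and let p₁, …, p_J : Σ → [0,1] be globally Lipschitz probability functions with Σ_j p_j(x) = 1 for all x and p_j(x) ≥ η for all x and j, for some η > 0. Suppose there exists δ > 0 such that for all x ≠ y in Σ one has Π_{j=1}^{J} ‖f_j(x) − f_j(y)‖^{p_j(x)} ≤ e^{−δ} ‖x − y‖ (average contractivity; this is the multiplicative form of Σ_j p_j(x) log(‖f_j(x) − f_j(y)‖ / ‖x − y‖) < −δ). Then the Markov kernel κ(x) = Σ_{j=1}^{J} p_j(x)·δ_{f_j(x)} admits an attractive, and hence unique, invariant probability measure μ: for every initial probability measure ν on Σ, the iterates ν_k converge weakly to μ. -/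

import Mathlib

open MeasureTheory ProbabilityTheory Filter Topology

/-- If a weighted geometric mean of numbers in `[0, K]` is at most `exp (-δ)`, with weights bounded
below by `η`, then the weighted mean of their `q`-th powers is at most some `ρ < 1`, where
`q` and `ρ` depend only on `K`, `η`, `δ`. -/
lemma exists_sum_rpow_le_of_prod_rpow_le {ι : Type*} [Fintype ι] {K η δ : ℝ} (hK : 1 ≤ K)
    (hη : 0 < η) (hδ : 0 < δ) :
    ∃ q ρ : ℝ, 0 < q ∧ q ≤ 1 ∧ 0 ≤ ρ ∧ ρ < 1 ∧ ∀ w r : ι → ℝ, (∀ j, η ≤ w j) →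
      ∑ j, w j = 1 → (∀ j, 0 ≤ r j) → (∀ j, r j ≤ K) → ∏ j, r j ^ w j ≤ Real.exp (-δ) →
      ∑ j, w j * r j ^ q ≤ ρ := by
  have hL : 0 ≤ Real.log K := Real.log_nonneg hK
  set M := (Real.log K + δ) / η with hM
  have hM0 : 0 < M := by positivity
  have hηM : η * M = Real.log K + δ := by rw [hM]; field_simp
  set N := M + Real.log K with hN
  have hN0 : 0 < N := by positivity
  set q := min 1 (min (1 / N) (δ / (2 * N ^ 2))) with hq
  have hq0 : 0 < q := by rw [hq]; positivity
  have hqN : q * N ≤ 1 := by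
    have : q ≤ 1 / N := (min_le_right _ _).trans (min_le_left _ _)
    rwa [le_div_iff₀ hN0] at this
  have hqN2 : q * N ^ 2 ≤ δ / 2 := by
    have : q ≤ δ / (2 * N ^ 2) := (min_le_right _ _).trans (min_le_right _ _)
    rw [le_div_iff₀ (by positivity)] at this
    linarith
  refine ⟨q, max 0 (1 - q * δ / 2), hq0, min_le_left _ _, le_max_left _ _,
    max_lt one_pos (by nlinarith), fun w r hw hw1 hr0 hrK hprod => le_max_of_le_right ?_⟩
  have hw0 : ∀ j, 0 ≤ w j := fun j => hη.le.trans (hw j)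
  set t : ι → ℝ := fun j => Real.log (max (r j) (Real.exp (-M))) with ht
  have hpos : ∀ j, 0 < max (r j) (Real.exp (-M)) := fun j =>
    lt_max_of_lt_right (Real.exp_pos _)
  have htM : ∀ j, -M ≤ t j := fun j => by
    rw [ht, Real.le_log_iff_exp_le (hpos j)]
    exact le_max_right _ _
  have htK : ∀ j, t j ≤ Real.log K := fun j => by
    refine Real.log_le_log (hpos j) (max_le (hrK j) (le_trans ?_ hK))
    exact Real.exp_le_one_iff.2 (by linarith)
  have hsum : ∑ j, w j * t j ≤ -δ := by
    by_cases h : ∀ j, Real.exp (-M) ≤ r j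
    · have hr : ∀ j, 0 < r j := fun j => (Real.exp_pos _).trans_le (h j)
      have h1 : ∑ j, w j * t j = Real.log (∏ j, r j ^ w j) := by
        rw [Real.log_prod (fun j _ => (Real.rpow_pos_of_pos (hr j) _).ne')]
        refine Finset.sum_congr rfl fun j _ => ?_
        rw [Real.log_rpow (hr j), ht]
        simp only [max_eq_left (h j)]
      rw [h1, ← Real.log_exp (-δ)]
      exact Real.log_le_log (Finset.prod_pos fun j _ => Real.rpow_pos_of_pos (hr j) _) hprod
    · push Not at h
      obtain ⟨i, hi⟩ := h
      have hti : t i = -M := by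
        rw [ht]
        simp only [max_eq_right hi.le, Real.log_exp]
      have h1 : w i * (Real.log K - t i) ≤ ∑ j, w j * (Real.log K - t j) :=
        Finset.single_le_sum (f := fun j => w j * (Real.log K - t j))
          (fun j _ => mul_nonneg (hw0 j) (sub_nonneg.2 (htK j))) (Finset.mem_univ i)
      have h2 : ∑ j, w j * (Real.log K - t j) = Real.log K - ∑ j, w j * t j := by
        simp only [mul_sub, Finset.sum_sub_distrib, ← Finset.sum_mul, hw1, one_mul]
      rw [hti, h2] at h1
      nlinarith [mul_le_mul_of_nonneg_right (hw i) hM0.le, mul_nonneg (hw0 i) hL]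
  have hterm : ∀ j, w j * r j ^ q ≤ w j * (1 + q * t j + q ^ 2 * N ^ 2) := fun j => by
    refine mul_le_mul_of_nonneg_left ?_ (hw0 j)
    have htN : |t j| ≤ N := abs_le.2 ⟨by linarith [htM j], by linarith [htK j]⟩
    have hqt : |q * t j| ≤ 1 := by
      rw [abs_mul, abs_of_pos hq0]
      exact (mul_le_mul_of_nonneg_left htN hq0.le).trans hqN
    have h1 : r j ^ q ≤ Real.exp (q * t j) := by
      calc r j ^ q ≤ max (r j) (Real.exp (-M)) ^ q :=
            Real.rpow_le_rpow (hr0 j) (le_max_left _ _) hq0.le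
        _ = Real.exp (q * t j) := by rw [Real.rpow_def_of_pos (hpos j), mul_comm]
    have h2 := (abs_le.1 (Real.abs_exp_sub_one_sub_id_le hqt)).2
    have h3 : (q * t j) ^ 2 ≤ q ^ 2 * N ^ 2 := by
      rw [mul_pow]
      exact mul_le_mul_of_nonneg_left (sq_le_sq' (abs_le.1 htN).1 (abs_le.1 htN).2)
        (sq_nonneg q)
    linarith
  calc ∑ j, w j * r j ^ q ≤ ∑ j, w j * (1 + q * t j + q ^ 2 * N ^ 2) :=
        Finset.sum_le_sum fun j _ => hterm j
    _ = 1 + q * ∑ j, w j * t j + q ^ 2 * N ^ 2 := by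
        simp only [mul_add, Finset.sum_add_distrib, mul_one, ← Finset.sum_mul, hw1, one_mul,
          Finset.mul_sum]
        congr 2
        exact Finset.sum_congr rfl fun j _ => by ring
    _ ≤ 1 - q * δ / 2 := by nlinarith

/-- Average contractivity yields contraction on average of a power of the distance. -/
lemma exists_average_dist_rpow_le {X ι : Type*} [MetricSpace X] [Fintype ι]
    {f : ι → X → X} {p : ι → X → ℝ} {η δ : ℝ} (hflip : ∀ j, ∃ K : NNReal, LipschitzWith K (f j))
    (hη : 0 < η) (hpsum : ∀ x, ∑ j, p j x = 1) (hpη : ∀ j x, η ≤ p j x) (hδ : 0 < δ)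
    (havg : ∀ x y : X, x ≠ y →
      ∏ j, dist (f j x) (f j y) ^ p j x ≤ Real.exp (-δ) * dist x y) :
    ∃ q ρ : ℝ, 0 < q ∧ q ≤ 1 ∧ 0 ≤ ρ ∧ ρ < 1 ∧
      ∀ x y, ∑ j, p j x * dist (f j x) (f j y) ^ q ≤ ρ * dist x y ^ q := by
  choose K hK using hflip
  obtain ⟨q, ρ, hq0, hq1, hρ0, hρ1, H⟩ := exists_sum_rpow_le_of_prod_rpow_le (ι := ι)
    (K := 1 + ∑ j, (K j : ℝ)) (le_add_of_nonneg_right (by positivity)) hη hδ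
  refine ⟨q, ρ, hq0, hq1, hρ0, hρ1, fun x y => ?_⟩
  rcases eq_or_ne x y with rfl | hxy
  · simp [Real.zero_rpow hq0.ne']
  have hd : 0 < dist x y := dist_pos.2 hxy
  have hdq : 0 < dist x y ^ q := Real.rpow_pos_of_pos hd q
  have h := H (fun j => p j x) (fun j => dist (f j x) (f j y) / dist x y) (fun j => hpη j x)
    (hpsum x) (fun j => by positivity) (fun j => ?_) ?_
  · simp only [Real.div_rpow dist_nonneg dist_nonneg, ← mul_div_assoc, ← Finset.sum_div] at h
    rwa [div_le_iff₀ hdq] at h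
  · rw [div_le_iff₀ hd]
    refine ((hK j).dist_le_mul x y).trans (mul_le_mul_of_nonneg_right ?_ hd.le)
    have := Finset.single_le_sum (f := fun j => (K j : ℝ)) (fun j _ => (K j).coe_nonneg)
      (Finset.mem_univ j)
    linarith
  · simp only [Real.div_rpow dist_nonneg dist_nonneg, Finset.prod_div_distrib]
    rw [← Real.rpow_sum_of_pos hd, hpsum, Real.rpow_one, div_le_iff₀ hd]
    exact havg x y hxy

/-- The operator `g ↦ (x ↦ ∑ j, p j x * g (f j x))` on functions attached to an iterated function
system with maps `f` and place-dependent probabilities `p`. -/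
def averageOp {X ι : Type*} [Fintype ι] (p : ι → X → ℝ) (f : ι → X → X) (g : X → ℝ) : X → ℝ :=
  fun x => ∑ j, p j x * g (f j x)

section Average

variable {X ι : Type*} [Fintype ι] {f : ι → X → X} {p : ι → X → ℝ}

lemma abs_averageOp_le (hp0 : ∀ j x, 0 ≤ p j x) (hpsum : ∀ x, ∑ j, p j x = 1) {g : X → ℝ} {B : ℝ}
    (hg : ∀ x, |g x| ≤ B) (x : X) : |averageOp p f g x| ≤ B :=
  calc |averageOp p f g x| ≤ ∑ j, |p j x * g (f j x)| := Finset.abs_sum_le_sum_abs _ _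
    _ ≤ ∑ j, p j x * B := Finset.sum_le_sum fun j _ => by
        rw [abs_mul, abs_of_nonneg (hp0 j x)]
        exact mul_le_mul_of_nonneg_left (hg _) (hp0 j x)
    _ = B := by rw [← Finset.sum_mul, hpsum, one_mul]

lemma abs_averageOp_iterate_le (hp0 : ∀ j x, 0 ≤ p j x) (hpsum : ∀ x, ∑ j, p j x = 1)
    {g : X → ℝ} {B : ℝ} (hg : ∀ x, |g x| ≤ B) (k : ℕ) (x : X) :
    |(averageOp p f)^[k] g x| ≤ B := by
  induction k generalizing x with
  | zero => exact hg x
  | succ k ih =>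
    rw [Function.iterate_succ_apply']
    exact abs_averageOp_le hp0 hpsum ih x

/-- The Doeblin–Fortet inequality: the iterates of the averaging operator are
equi-Lipschitz with respect to a distance contracted on average. -/
lemma abs_averageOp_iterate_sub_le (hp0 : ∀ j x, 0 ≤ p j x) (hpsum : ∀ x, ∑ j, p j x = 1)
    {e : X → X → ℝ} {ρ D : ℝ} (hρ1 : ρ < 1) (he0 : ∀ x y, 0 ≤ e x y)
    (hctr : ∀ x y, ∑ j, p j x * e (f j x) (f j y) ≤ ρ * e x y)
    (hD0 : 0 ≤ D) (hD : ∀ x y, ∑ j, |p j x - p j y| ≤ D * e x y)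
    {g : X → ℝ} {A B : ℝ} (hA : 0 ≤ A) (hg : ∀ x, |g x| ≤ B)
    (hgA : ∀ x y, |g x - g y| ≤ A * e x y) (k : ℕ) (x y : X) :
    |(averageOp p f)^[k] g x - (averageOp p f)^[k] g y| ≤ (A + D * B / (1 - ρ)) * e x y := by
  have hB : 0 ≤ B := (abs_nonneg _).trans (hg x)
  have hρ : 0 < 1 - ρ := sub_pos.2 hρ1
  induction k generalizing x y with
  | zero =>
    refine (hgA x y).trans (mul_le_mul_of_nonneg_right ?_ (he0 x y))
    have : 0 ≤ D * B / (1 - ρ) := by positivity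
    linarith
  | succ k ih =>
    rw [Function.iterate_succ_apply']
    set h := (averageOp p f)^[k] g
    have hhB : ∀ x, |h x| ≤ B := abs_averageOp_iterate_le hp0 hpsum hg k
    set A' := A + D * B / (1 - ρ)
    have hA' : 0 ≤ A' := by positivity
    have h1 : averageOp p f h x - averageOp p f h y =
        ∑ j, p j x * (h (f j x) - h (f j y)) + ∑ j, (p j x - p j y) * h (f j y) := by
      simp only [averageOp, ← Finset.sum_sub_distrib, ← Finset.sum_add_distrib]
      exact Finset.sum_congr rfl fun j _ => by ring
    have h2 : |∑ j, p j x * (h (f j x) - h (f j y))| ≤ A' * (ρ * e x y) :=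
      calc _ ≤ ∑ j, |p j x * (h (f j x) - h (f j y))| := Finset.abs_sum_le_sum_abs _ _
        _ ≤ ∑ j, A' * (p j x * e (f j x) (f j y)) := Finset.sum_le_sum fun j _ => by
            rw [abs_mul, abs_of_nonneg (hp0 j x), mul_left_comm]
            exact mul_le_mul_of_nonneg_left (ih _ _) (hp0 j x)
        _ ≤ _ := by
            rw [← Finset.mul_sum]
            exact mul_le_mul_of_nonneg_left (hctr x y) hA'
    have h3 : |∑ j, (p j x - p j y) * h (f j y)| ≤ D * e x y * B :=
      calc _ ≤ ∑ j, |(p j x - p j y) * h (f j y)| := Finset.abs_sum_le_sum_abs _ _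
        _ ≤ ∑ j, |p j x - p j y| * B := Finset.sum_le_sum fun j _ => by
            rw [abs_mul]
            exact mul_le_mul_of_nonneg_left (hhB _) (abs_nonneg _)
        _ ≤ _ := by
            rw [← Finset.sum_mul]
            exact mul_le_mul_of_nonneg_right (hD x y) hB
    rw [h1]
    refine (abs_add_le _ _).trans ((add_le_add h2 h3).trans ?_)
    have h4 : A' * ρ + D * B ≤ A' := by
      have : A' * (1 - ρ) = A * (1 - ρ) + D * B := by
        simp only [A']; field_simp
      nlinarith [mul_nonneg hA hρ.le]
    nlinarith [mul_le_mul_of_nonneg_right h4 (he0 x y)]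

/-- A bound on the iterates of the averaging operator on functions dominated by a
Lyapunov function. -/
lemma averageOp_iterate_le_of_le (hp0 : ∀ j x, 0 ≤ p j x) (hpsum : ∀ x, ∑ j, p j x = 1)
    {V : X → ℝ} {ρ K : ℝ} (hρ0 : 0 ≤ ρ) (hV : ∀ x, averageOp p f V x ≤ ρ * V x + (1 - ρ) * K)
    {g : X → ℝ} {b c : ℝ} (hc : 0 ≤ c) (hg : ∀ x, g x ≤ b + c * V x) (k : ℕ) (x : X) :
    (averageOp p f)^[k] g x ≤ b + c * (ρ ^ k * V x + (1 - ρ ^ k) * K) := by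
  induction k generalizing x with
  | zero => simpa using hg x
  | succ k ih =>
    rw [Function.iterate_succ_apply']
    calc averageOp p f ((averageOp p f)^[k] g) x
        ≤ ∑ j, p j x * (b + c * (ρ ^ k * V (f j x) + (1 - ρ ^ k) * K)) :=
          Finset.sum_le_sum fun j _ => mul_le_mul_of_nonneg_left (ih _) (hp0 j x)
      _ = b + c * (ρ ^ k * averageOp p f V x + (1 - ρ ^ k) * K) := by
          simp only [averageOp, mul_add, Finset.sum_add_distrib, ← Finset.sum_mul, hpsum,
            one_mul, Finset.mul_sum]
          congr 2
          exact Finset.sum_congr rfl fun j _ => by ring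
      _ ≤ b + c * (ρ ^ (k + 1) * V x + (1 - ρ ^ (k + 1)) * K) := by
          have h := mul_le_mul_of_nonneg_left (hV x) (pow_nonneg hρ0 k)
          gcongr b + c * ?_
          calc _ ≤ ρ ^ k * (ρ * V x + (1 - ρ) * K) + (1 - ρ ^ k) * K := by linarith
            _ = _ := by ring

lemma le_averageOp_iterate (hp0 : ∀ j x, 0 ≤ p j x) {a : X → ℝ}
    (ha : ∀ x, a x ≤ averageOp p f a x) (k : ℕ) (x : X) : a x ≤ (averageOp p f)^[k] a x := by
  induction k generalizing x with
  | zero => exact le_rfl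
  | succ k ih =>
    rw [Function.iterate_succ_apply']
    exact (ha x).trans
      (Finset.sum_le_sum fun j _ => mul_le_mul_of_nonneg_left (ih _) (hp0 j x))

/-- A bounded subinvariant function dominated by `A * e` is nonpositive, provided that at each point
one of the maps, chosen with probability at least `η`, contracts `e`, and that `e` is dominated by
a Lyapunov function. -/
lemma nonpos_of_le_averageOp (hp0 : ∀ j x, 0 ≤ p j x) (hpsum : ∀ x, ∑ j, p j x = 1)
    {e V a : X → ℝ} {η ρ K A : ℝ} (hη : 0 < η) (hρ0 : 0 ≤ ρ) (hρ1 : ρ < 1) (hA : 0 ≤ A)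
    (hK : 0 ≤ K) (hV0 : ∀ x, 0 ≤ V x)
    (hV : ∀ x, averageOp p f V x ≤ ρ * V x + (1 - ρ) * K) (heV : ∀ x, e x ≤ V x)
    (he : ∀ x, ∃ j, η ≤ p j x ∧ e (f j x) ≤ ρ * e x)
    (hbdd : BddAbove (Set.range a)) (haA : ∀ x, a x ≤ A * e x)
    (ha : ∀ x, a x ≤ averageOp p f a x) (x : X) : a x ≤ 0 := by
  have : Nonempty X := ⟨x⟩
  set S := ⨆ x, a x with hS
  have haS : ∀ x, a x ≤ S := le_ciSup hbdd
  by_contra! hx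
  have hS0 : 0 < S := hx.trans_le (haS x)
  have hη1 : η ≤ 1 := by
    obtain ⟨j, hj, -⟩ := he x
    refine hj.trans ?_
    rw [← hpsum x]
    exact Finset.single_le_sum (f := fun j => p j x) (fun j _ => hp0 j x) (Finset.mem_univ j)
  have hstep : ∀ (n : ℕ) (x : X), A * ρ ^ n * e x ≤ S / 2 → a x ≤ S - η ^ n / 2 * S := by
    intro n
    induction n with
    | zero =>
      intro x hx
      have := haA x
      simp only [pow_zero, mul_one] at hx ⊢
      linarith
    | succ n ih =>
      intro x hx
      obtain ⟨j, hj, hej⟩ := he x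
      have h1 : a (f j x) ≤ S - η ^ n / 2 * S := by
        refine ih _ (le_trans ?_ hx)
        rw [pow_succ, ← mul_assoc, mul_assoc (A * ρ ^ n)]
        exact mul_le_mul_of_nonneg_left hej (by positivity)
      have h2 : p j x * (S - a (f j x)) ≤ ∑ j, p j x * (S - a (f j x)) :=
        Finset.single_le_sum (f := fun j => p j x * (S - a (f j x)))
          (fun j _ => mul_nonneg (hp0 j x) (sub_nonneg.2 (haS _))) (Finset.mem_univ j)
      have h3 : ∑ j, p j x * (S - a (f j x)) = S - averageOp p f a x := by
        simp only [mul_sub, Finset.sum_sub_distrib, ← Finset.sum_mul, hpsum, one_mul, averageOp]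
      have h4 : η * (η ^ n / 2 * S) ≤ p j x * (S - a (f j x)) :=
        mul_le_mul hj (by linarith) (by positivity) (hp0 j x)
      have h5 := ha x
      rw [pow_succ']
      linarith
  set R := 2 * K + 1 with hR
  have hR0 : 0 < R := by positivity
  obtain ⟨n, hn⟩ : ∃ n : ℕ, A * ρ ^ n * R ≤ S / 2 := by
    have h : Tendsto (fun n : ℕ => A * ρ ^ n * R) atTop (𝓝 (A * 0 * R)) :=
      ((tendsto_pow_atTop_nhds_zero_of_lt_one hρ0 hρ1).const_mul A).mul_const R
    rw [mul_zero, zero_mul] at h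
    exact (h.eventually_le_const (half_pos hS0)).exists
  set θ := η ^ n / 2 with hθ
  have hθ0 : 0 < θ := by positivity
  have hbound : ∀ x, a x ≤ (S - θ * S) + θ * S / R * V x := fun x => by
    have h0 : 0 ≤ θ * S / R := by positivity
    rcases le_total (V x) R with h | h
    · have h1 : a x ≤ S - θ * S := by
        refine hstep n x (le_trans ?_ hn)
        exact mul_le_mul_of_nonneg_left ((heV x).trans h) (by positivity)
      linarith [mul_nonneg h0 (hV0 x)]
    · have h1 := mul_le_mul_of_nonneg_left h h0
      rw [div_mul_cancel₀ _ hR0.ne'] at h1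
      linarith [haS x]
  have hlim : ∀ x, a x ≤ (S - θ * S) + θ * S / R * K := fun x => by
    have h : Tendsto (fun k : ℕ => (S - θ * S) + θ * S / R * (ρ ^ k * V x + (1 - ρ ^ k) * K))
        atTop (𝓝 ((S - θ * S) + θ * S / R * (0 * V x + (1 - 0) * K))) := by
      have h0 := tendsto_pow_atTop_nhds_zero_of_lt_one hρ0 hρ1
      exact (((h0.mul_const _).add ((h0.const_sub 1).mul_const _)).const_mul _).const_add _
    rw [zero_mul, sub_zero, one_mul, zero_add] at h
    exact ge_of_tendsto' h fun k => (le_averageOp_iterate hp0 ha k x).trans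
      (averageOp_iterate_le_of_le hp0 hpsum hρ0 hV (by positivity) hbound k x)
  have hS' : S ≤ (S - θ * S) + θ * S / R * K := ciSup_le hlim
  have h1 : θ * S / R * K ≤ θ * S / 2 := by
    rw [div_mul_eq_mul_div, div_le_div_iff₀ hR0 two_pos]
    nlinarith [mul_pos hθ0 hS0]
  nlinarith [mul_pos hθ0 hS0]

lemma exists_le_of_weighted_sum_le [Nonempty ι] (hp0 : ∀ j x, 0 ≤ p j x)
    (hpsum : ∀ x, ∑ j, p j x = 1) {u : ι → ℝ} {c : ℝ} (x : X)
    (h : ∑ j, p j x * u j ≤ c) : ∃ j, u j ≤ c := by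
  by_contra! hc
  obtain ⟨j, -, hj⟩ := Finset.exists_lt_of_sum_lt (s := Finset.univ)
    (f := fun _ : ι => (0 : ℝ)) (g := fun j => p j x) (by simp [hpsum])
  have : ∑ j, p j x * c < ∑ j, p j x * u j := Finset.sum_lt_sum
    (fun i _ => mul_le_mul_of_nonneg_left (hc i).le (hp0 i x))
    ⟨j, Finset.mem_univ j, mul_lt_mul_of_pos_left (hc j) hj⟩
  rw [← Finset.sum_mul, hpsum, one_mul] at this
  linarith

/-- Asymptotic constancy of the iterates of the averaging operator, by running two independent
copies of the process. -/
lemma tendsto_averageOp_iterate_sub (hp0 : ∀ j x, 0 ≤ p j x) (hpsum : ∀ x, ∑ j, p j x = 1)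
    {η : ℝ} (hη : 0 < η) (hpη : ∀ j x, η ≤ p j x)
    {e : X → X → ℝ} {ρ D : ℝ} (hρ0 : 0 ≤ ρ) (hρ1 : ρ < 1) (he0 : ∀ x y, 0 ≤ e x y)
    (hctr : ∀ x y, ∑ j, p j x * e (f j x) (f j y) ≤ ρ * e x y)
    (hD0 : 0 ≤ D) (hD : ∀ x y, ∑ j, |p j x - p j y| ≤ D * e x y)
    {V : X → ℝ} {K : ℝ} (hK : 0 ≤ K) (hV0 : ∀ x, 0 ≤ V x)
    (hV : ∀ x, averageOp p f V x ≤ ρ * V x + (1 - ρ) * K) (heV : ∀ x y, e x y ≤ V x + V y)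
    {g : X → ℝ} {A B : ℝ} (hA : 0 ≤ A) (hg : ∀ x, |g x| ≤ B)
    (hgA : ∀ x y, |g x - g y| ≤ A * e x y) (x y : X) :
    Tendsto (fun k => (averageOp p f)^[k] g x - (averageOp p f)^[k] g y) atTop (𝓝 0) := by
  have hB : 0 ≤ B := (abs_nonneg _).trans (hg x)
  have : Nonempty ι := by
    by_contra h
    rw [not_nonempty_iff] at h
    simpa using hpsum x
  set h : ℕ → X → ℝ := fun k => (averageOp p f)^[k] g with hh
  set d : ℕ → X × X → ℝ := fun k z => |h k z.1 - h k z.2| with hd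
  have hd2B : ∀ k z, d k z ≤ B + B := fun k z =>
    (abs_sub _ _).trans (add_le_add (abs_averageOp_iterate_le hp0 hpsum hg k _)
      (abs_averageOp_iterate_le hp0 hpsum hg k _))
  have hd0 : ∀ k z, 0 ≤ d k z := fun k z => abs_nonneg _
  have hub : ∀ z, IsBoundedUnder (· ≤ ·) atTop (fun k => d k z) := fun z =>
    isBoundedUnder_of ⟨B + B, fun k => hd2B k z⟩
  have hcob : ∀ z, IsCoboundedUnder (· ≤ ·) atTop (fun k => d k z) := fun z =>
    (isBoundedUnder_of ⟨0, fun k => hd0 k z⟩ : IsBoundedUnder (· ≥ ·) atTop _).isCoboundedUnder_le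
  set a : X × X → ℝ := fun z => limsup (fun k => d k z) atTop with ha
  set P : ι × ι → X × X → ℝ := fun i z => p i.1 z.1 * p i.2 z.2 with hP
  set F : ι × ι → X × X → X × X := fun i z => (f i.1 z.1, f i.2 z.2) with hF
  have hP0 : ∀ i z, 0 ≤ P i z := fun i z => mul_nonneg (hp0 _ _) (hp0 _ _)
  have hfst : ∀ (u : ι → ℝ) z, ∑ i, P i z * u i.1 = ∑ j, p j z.1 * u j := fun u z => by
    simp only [hP, Fintype.sum_prod_type, ← Finset.mul_sum, ← Finset.sum_mul, hpsum, mul_one]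
  have hsnd : ∀ (u : ι → ℝ) z, ∑ i, P i z * u i.2 = ∑ j, p j z.2 * u j := fun u z => by
    simp only [hP, Fintype.sum_prod_type, mul_assoc, ← Finset.mul_sum, ← Finset.sum_mul, hpsum,
      one_mul]
  have hPsum : ∀ z, ∑ i, P i z = 1 := fun z => by
    simpa [hpsum] using hfst (fun _ => 1) z
  have hdsucc : ∀ k z, d (k + 1) z ≤ ∑ i, P i z * d k (F i z) := fun k z => by
    have h1 : h (k + 1) z.1 - h (k + 1) z.2 =
        ∑ i, P i z * (h k (f i.1 z.1) - h k (f i.2 z.2)) := by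
      simp only [mul_sub, Finset.sum_sub_distrib]
      rw [hfst (fun j => h k (f j z.1)) z, hsnd (fun j => h k (f j z.2)) z]
      simp only [hh, Function.iterate_succ_apply', averageOp]
    simp only [hd, h1]
    refine (Finset.abs_sum_le_sum_abs _ _).trans (Finset.sum_le_sum fun i _ => ?_)
    rw [abs_mul, abs_of_nonneg (hP0 i z)]
  have hasub : ∀ z, a z ≤ averageOp P F a z := fun z => by
    refine le_of_forall_pos_le_add fun ε hε => ?_
    have hev : ∀ᶠ k in atTop, ∀ i, d k (F i z) < a (F i z) + ε :=
      eventually_all.2 fun i =>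
        eventually_lt_of_limsup_lt (lt_add_of_pos_right _ hε) (hub (F i z))
    refine limsup_le_of_le (hcob z) ?_
    rw [← map_add_atTop_eq_nat 1, eventually_map]
    filter_upwards [hev] with k hk
    calc d (k + 1) z ≤ ∑ i, P i z * d k (F i z) := hdsucc k z
      _ ≤ ∑ i, P i z * (a (F i z) + ε) :=
          Finset.sum_le_sum fun i _ => mul_le_mul_of_nonneg_left (hk i).le (hP0 i z)
      _ = averageOp P F a z + ε := by
          simp only [mul_add, Finset.sum_add_distrib, ← Finset.sum_mul, hPsum, one_mul, averageOp]
  have haz : a (x, y) ≤ 0 := by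
    refine nonpos_of_le_averageOp (p := P) (f := F) (e := fun z => e z.1 z.2)
      (V := fun z => V z.1 + V z.2) (η := η * η) (ρ := ρ) (K := K + K)
      (A := A + D * B / (1 - ρ)) hP0 hPsum (mul_pos hη hη) hρ0 hρ1 ?_ (add_nonneg hK hK)
      (fun z => add_nonneg (hV0 _) (hV0 _)) (fun z => ?_) (fun z => heV _ _) (fun z => ?_)
      ⟨B + B, ?_⟩ (fun z => ?_) hasub (x, y)
    · have := sub_pos.2 hρ1
      positivity
    · have h1 : averageOp P F (fun z => V z.1 + V z.2) z =
          averageOp p f V z.1 + averageOp p f V z.2 := by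
        simp only [averageOp, mul_add, Finset.sum_add_distrib, hF]
        rw [hfst (fun j => V (f j z.1)) z, hsnd (fun j => V (f j z.2)) z]
      rw [h1]
      linarith [hV z.1, hV z.2]
    · obtain ⟨j, hj⟩ := exists_le_of_weighted_sum_le hp0 hpsum z.1 (hctr z.1 z.2)
      exact ⟨(j, j), mul_le_mul (hpη _ _) (hpη _ _) hη.le (hp0 _ _), hj⟩
    · rintro _ ⟨z, rfl⟩
      exact limsup_le_of_le (hcob z) (Eventually.of_forall fun k => hd2B k z)
    · exact limsup_le_of_le (hcob z) (Eventually.of_forall fun k =>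
        abs_averageOp_iterate_sub_le hp0 hpsum hρ1 he0 hctr hD0 hD hA hg hgA k z.1 z.2)
  rw [tendsto_zero_iff_abs_tendsto_zero]
  refine tendsto_order.2 ⟨fun b hb => Eventually.of_forall fun k => hb.trans_le (abs_nonneg _),
    fun b hb => ?_⟩
  exact eventually_lt_of_limsup_lt (haz.trans_lt hb) (hub (x, y))

end Average

section Kernel

variable {X ι : Type*} [Fintype ι] {f : ι → X → X} {p : ι → X → ℝ}

lemma continuous_averageOp [TopologicalSpace X] (hf : ∀ j, Continuous (f j))
    (hp : ∀ j, Continuous (p j)) {g : X → ℝ} (hg : Continuous g) :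
    Continuous (averageOp p f g) :=
  continuous_finsetSum _ fun j _ => (hp j).mul (hg.comp (hf j))

lemma continuous_averageOp_iterate [TopologicalSpace X] (hf : ∀ j, Continuous (f j))
    (hp : ∀ j, Continuous (p j)) {g : X → ℝ} (hg : Continuous g) (k : ℕ) :
    Continuous ((averageOp p f)^[k] g) := by
  induction k with
  | zero => exact hg
  | succ k ih =>
    rw [Function.iterate_succ_apply']
    exact continuous_averageOp hf hp ih

lemma integrable_of_continuous_of_abs_le [TopologicalSpace X] [MeasurableSpace X]
    [OpensMeasurableSpace X] {ν : Measure X} [IsFiniteMeasure ν] {g : X → ℝ} {B : ℝ}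
    (hg : Continuous g) (hB : ∀ x, |g x| ≤ B) : Integrable g ν :=
  .of_bound hg.measurable.aestronglyMeasurable B (Eventually.of_forall hB)

lemma isMarkovKernel_of_eq_sum_dirac [MeasurableSpace X] (hp0 : ∀ j x, 0 ≤ p j x)
    (hpsum : ∀ x, ∑ j, p j x = 1) {κ : Kernel X X}
    (hκ : ∀ x, κ x = ∑ j, ENNReal.ofReal (p j x) • Measure.dirac (f j x)) : IsMarkovKernel κ := by
  refine ⟨fun x => ⟨?_⟩⟩
  simp only [hκ, Measure.coe_finsetSum, Finset.sum_apply, Measure.smul_apply, measure_univ,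
    smul_eq_mul, mul_one]
  rw [← ENNReal.ofReal_sum_of_nonneg fun j _ => hp0 j x, hpsum, ENNReal.ofReal_one]

lemma isProbabilityMeasure_of_succ_eq_bind [MeasurableSpace X] {κ : Kernel X X} [IsMarkovKernel κ]
    {ν : ℕ → Measure X} (h0 : IsProbabilityMeasure (ν 0)) (hν : ∀ k, ν (k + 1) = (ν k).bind κ)
    (k : ℕ) : IsProbabilityMeasure (ν k) := by
  induction k with
  | zero => exact h0
  | succ k ih => rw [hν]; infer_instance

variable [TopologicalSpace X] [MeasurableSpace X] [BorelSpace X]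

lemma integral_eq_averageOp (hp0 : ∀ j x, 0 ≤ p j x) {κ : Kernel X X}
    (hκ : ∀ x, κ x = ∑ j, ENNReal.ofReal (p j x) • Measure.dirac (f j x)) {g : X → ℝ} {B : ℝ}
    (hg : Continuous g) (hB : ∀ x, |g x| ≤ B) (x : X) :
    ∫ y, g y ∂(κ x) = averageOp p f g x := by
  rw [hκ, integral_finsetSum_measure fun j _ =>
    (integrable_of_continuous_of_abs_le hg hB).smul_measure ENNReal.ofReal_ne_top]
  refine Finset.sum_congr rfl fun j _ => ?_
  rw [integral_smul_measure, integral_dirac' _ _ hg.measurable.stronglyMeasurable,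
    ENNReal.toReal_ofReal (hp0 j x), smul_eq_mul]

lemma integral_bind_eq_integral_averageOp (hp0 : ∀ j x, 0 ≤ p j x) {κ : Kernel X X}
    [IsMarkovKernel κ]
    (hκ : ∀ x, κ x = ∑ j, ENNReal.ofReal (p j x) • Measure.dirac (f j x)) {g : X → ℝ} {B : ℝ}
    (hg : Continuous g) (hB : ∀ x, |g x| ≤ B) (ν : Measure X) [IsProbabilityMeasure ν] :
    ∫ x, g x ∂(ν.bind κ) = ∫ x, averageOp p f g x ∂ν := by
  have hint : Integrable g (ν.bind κ) := integrable_of_continuous_of_abs_le hg hB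
  rw [Measure.comp_eq_comp_const_apply] at hint ⊢
  rw [Kernel.integral_comp hint, Kernel.const_apply]
  exact integral_congr_ae (Eventually.of_forall (integral_eq_averageOp hp0 hκ hg hB))

lemma integral_eq_integral_averageOp_iterate (hf : ∀ j, Continuous (f j))
    (hp : ∀ j, Continuous (p j)) (hp0 : ∀ j x, 0 ≤ p j x) (hpsum : ∀ x, ∑ j, p j x = 1)
    {κ : Kernel X X} [IsMarkovKernel κ]
    (hκ : ∀ x, κ x = ∑ j, ENNReal.ofReal (p j x) • Measure.dirac (f j x)) {B : ℝ}
    {ν : ℕ → Measure X} (h0 : IsProbabilityMeasure (ν 0)) (hν : ∀ k, ν (k + 1) = (ν k).bind κ)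
    (k : ℕ) {g : X → ℝ} (hg : Continuous g) (hB : ∀ x, |g x| ≤ B) :
    ∫ x, g x ∂(ν k) = ∫ x, (averageOp p f)^[k] g x ∂(ν 0) := by
  induction k generalizing g with
  | zero => rfl
  | succ k ih =>
    have := isProbabilityMeasure_of_succ_eq_bind h0 hν k
    rw [hν, integral_bind_eq_integral_averageOp hp0 hκ hg hB,
      ih (continuous_averageOp hf hp hg) (abs_averageOp_le hp0 hpsum hB),
      Function.iterate_succ_apply]

lemma tendsto_integral_averageOp_iterate_sub (hf : ∀ j, Continuous (f j))
    (hp : ∀ j, Continuous (p j)) (hp0 : ∀ j x, 0 ≤ p j x) (hpsum : ∀ x, ∑ j, p j x = 1)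
    {g : X → ℝ} {B : ℝ} (hg : Continuous g) (hB : ∀ x, |g x| ≤ B)
    (hlim : ∀ x y, Tendsto (fun k => (averageOp p f)^[k] g x - (averageOp p f)^[k] g y)
      atTop (𝓝 0)) (ν : Measure X) [IsProbabilityMeasure ν] (y : X) :
    Tendsto (fun k => ∫ x, (averageOp p f)^[k] g x ∂ν - (averageOp p f)^[k] g y)
      atTop (𝓝 0) := by
  have hc := continuous_averageOp_iterate hf hp hg
  have hb := abs_averageOp_iterate_le (f := f) hp0 hpsum hB
  have h : Tendsto (fun k => ∫ x, ((averageOp p f)^[k] g x - (averageOp p f)^[k] g y) ∂ν)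
      atTop (𝓝 (∫ _, (0 : ℝ) ∂ν)) := by
    refine tendsto_integral_of_dominated_convergence (fun _ => B + B)
      (fun k => ((hc k).sub continuous_const).measurable.aestronglyMeasurable)
      (integrable_const _) (fun k => Eventually.of_forall fun x => ?_)
      (Eventually.of_forall fun x => hlim x y)
    exact (abs_sub _ _).trans (add_le_add (hb k x) (hb k y))
  rw [integral_zero] at h
  refine h.congr fun k => ?_
  rw [integral_sub (integrable_of_continuous_of_abs_le (hc k) (hb k)) (integrable_const _)]
  simp

end Kernel

/-- The kernel of an iterated function system on a proper metric space has an
attractive invariant measure as soon as the iterates of the averaging operator on bounded Lipschitz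
functions are asymptotically constant and a Lyapunov function exists. -/
lemma exists_attractive_invariant_measure {X ι : Type*} [Fintype ι] [MetricSpace X] [ProperSpace X]
    [MeasurableSpace X] [BorelSpace X] [Nonempty X]
    {f : ι → X → X} {p : ι → X → ℝ} (hf : ∀ j, Continuous (f j))
    (hp : ∀ j, Continuous (p j)) (hp0 : ∀ j x, 0 ≤ p j x) (hpsum : ∀ x, ∑ j, p j x = 1)
    {κ : Kernel X X} (hκ : ∀ x, κ x = ∑ j, ENNReal.ofReal (p j x) • Measure.dirac (f j x))
    {V : X → ℝ} {ρ K : ℝ} (hρ0 : 0 ≤ ρ) (hρ1 : ρ < 1) (hK : 0 ≤ K) (hVc : Continuous V)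
    (hV0 : ∀ x, 0 ≤ V x) (hVK : ∀ R, IsCompact {x | V x ≤ R})
    (hV : ∀ x, averageOp p f V x ≤ ρ * V x + (1 - ρ) * K)
    (hlim : ∀ (g : X → ℝ) (L : NNReal) (B : ℝ), LipschitzWith L g → (∀ x, |g x| ≤ B) → ∀ x y,
      Tendsto (fun k => (averageOp p f)^[k] g x - (averageOp p f)^[k] g y) atTop (𝓝 0)) :
    ∃ μ : Measure X, IsProbabilityMeasure μ ∧ Kernel.Invariant κ μ ∧
      (∀ μ' : Measure X, IsProbabilityMeasure μ' → Kernel.Invariant κ μ' → μ' = μ) ∧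
      (∀ ν : Measure X, IsProbabilityMeasure ν →
        ∀ νiter : ℕ → Measure X, νiter 0 = ν →
          (∀ k, νiter (k + 1) = (νiter k).bind κ) →
          ∀ g : BoundedContinuousFunction X ℝ,
            Tendsto (fun k => ∫ x, g x ∂(νiter k)) atTop (𝓝 (∫ x, g x ∂μ))) := by
  have : IsMarkovKernel κ := isMarkovKernel_of_eq_sum_dirac hp0 hpsum hκ
  obtain ⟨x₀⟩ := ‹Nonempty X›
  have hbdd : ∀ g : X → ℝ, (∃ C, ∀ x y, dist (g x) (g y) ≤ C) → ∃ B, ∀ x, |g x| ≤ B := by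
    rintro g ⟨C, hC⟩
    refine ⟨C + |g x₀|, fun x => ?_⟩
    have h1 := hC x x₀
    rw [Real.dist_eq] at h1
    linarith [abs_sub_abs_le_abs_sub (g x) (g x₀)]
  -- the orbit of the Dirac mass at a base point
  set m : ℕ → Measure X := fun k => (fun ν : Measure X => ν.bind κ)^[k] (Measure.dirac x₀) with hm
  have hm0 : m 0 = Measure.dirac x₀ := rfl
  have hmsucc : ∀ k, m (k + 1) = (m k).bind κ := fun k => Function.iterate_succ_apply' _ _ _
  have hm0' : IsProbabilityMeasure (m 0) := by rw [hm0]; infer_instance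
  have hmP := isProbabilityMeasure_of_succ_eq_bind hm0' hmsucc
  have hmint : ∀ (k : ℕ) {g : X → ℝ} {B : ℝ}, Continuous g → (∀ x, |g x| ≤ B) →
      ∫ x, g x ∂(m k) = (averageOp p f)^[k] g x₀ := fun k g B hg hB => by
    rw [integral_eq_integral_averageOp_iterate hf hp hp0 hpsum hκ hm0' hmsucc k hg hB, hm0,
      integral_dirac' _ _
        (continuous_averageOp_iterate hf hp hg k).measurable.stronglyMeasurable]
  let mP : ℕ → ProbabilityMeasure X := fun k => ⟨m k, hmP k⟩
  have htight : IsTightMeasureSet {((μ : ProbabilityMeasure X) : Measure X) | μ ∈ Set.range mP} := by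
    rw [isTightMeasureSet_iff_exists_isCompact_measure_compl_le]
    intro ε hε
    obtain ⟨r, hr0, hr⟩ : ∃ r : ℝ, 0 < r ∧ ENNReal.ofReal r ≤ ε := by
      obtain ⟨r, hr0, hr⟩ := ENNReal.lt_iff_exists_nnreal_btwn.1 hε
      exact ⟨r, by exact_mod_cast hr0, by simpa using hr.le⟩
    set R := (V x₀ + K + 1) / r with hR
    have hV0' := hV0 x₀
    have hR0 : 0 < R := by positivity
    refine ⟨{x | V x ≤ R}, hVK R, ?_⟩
    rintro _ ⟨_, ⟨k, rfl⟩, rfl⟩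
    set g : X → ℝ := fun x => min 1 (V x / R) with hgdef
    have hg0 : ∀ x, 0 ≤ g x := fun x => le_min zero_le_one (div_nonneg (hV0 x) hR0.le)
    have hgc : Continuous g := continuous_const.min (hVc.div_const R)
    have hgB : ∀ x, |g x| ≤ 1 := fun x => by
      rw [abs_of_nonneg (hg0 x)]
      exact min_le_left _ _
    have h1 : (averageOp p f)^[k] g x₀ ≤ 0 + R⁻¹ * (ρ ^ k * V x₀ + (1 - ρ ^ k) * K) :=
      averageOp_iterate_le_of_le hp0 hpsum hρ0 hV (inv_nonneg.2 hR0.le)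
        (fun x => (min_le_right _ _).trans (by rw [zero_add, div_eq_inv_mul])) k x₀
    have hk0 := pow_nonneg hρ0 k
    have hk1 := pow_le_one₀ (n := k) hρ0 hρ1.le
    have h2 : R⁻¹ * (ρ ^ k * V x₀ + (1 - ρ ^ k) * K) ≤ r := by
      rw [inv_mul_le_iff₀ hR0, hR, div_mul_cancel₀ _ hr0.ne']
      nlinarith [mul_le_mul_of_nonneg_right hk1 hV0', mul_nonneg hk0 hK]
    have h3 : (m k).real {x | 1 ≤ g x} ≤ ∫ x, g x ∂(m k) := by
      simpa using mul_meas_ge_le_integral_of_nonneg (Eventually.of_forall hg0)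
        (integrable_of_continuous_of_abs_le (ν := m k) hgc hgB) 1
    have h4 : {x | V x ≤ R}ᶜ ⊆ {x | 1 ≤ g x} := fun x hx => by
      have hx' : R < V x := by simpa using hx
      exact le_min le_rfl ((one_le_div hR0).2 hx'.le)
    rw [hmint k hgc hgB] at h3
    have h5 : (m k).real {x | 1 ≤ g x} ≤ r := by linarith
    calc (m k) {x | V x ≤ R}ᶜ ≤ (m k) {x | 1 ≤ g x} := measure_mono h4
      _ = ENNReal.ofReal ((m k).real {x | 1 ≤ g x}) := (ofReal_measureReal).symm
      _ ≤ ENNReal.ofReal r := ENNReal.ofReal_le_ofReal h5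
      _ ≤ ε := hr
  have hcpt := isCompact_closure_of_isTightMeasureSet htight
  let U : Ultrafilter ℕ := Ultrafilter.of atTop
  have hU : (U : Filter ℕ) ≤ atTop := Ultrafilter.of_le atTop
  obtain ⟨μ, -, hμ⟩ := hcpt.ultrafilter_le_nhds (U.map mP)
    (le_principal_iff.2 (Filter.mem_map.2 (Filter.univ_mem' fun k =>
      subset_closure (Set.mem_range_self k))))
  have hμ' : Tendsto mP U (𝓝 μ) := hμ
  rw [ProbabilityMeasure.tendsto_iff_forall_integral_tendsto] at hμ'
  have hμint : ∀ {g : X → ℝ} {B : ℝ}, Continuous g → (∀ x, |g x| ≤ B) →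
      Tendsto (fun k => (averageOp p f)^[k] g x₀) U (𝓝 (∫ x, g x ∂(μ : Measure X))) := by
    intro g B hg hB
    have h := hμ' (BoundedContinuousFunction.ofNormedAddCommGroup g hg B hB)
    exact h.congr fun k => hmint k hg hB
  have hinv : Kernel.Invariant κ (μ : Measure X) := by
    let μ₁ : ProbabilityMeasure X := ⟨(μ : Measure X).bind κ, inferInstance⟩
    have h : Tendsto (fun _ : ℕ => μ₁) atTop (𝓝 μ) := by
      rw [tendsto_iff_forall_lipschitz_integral_tendsto]
      rintro g hgC ⟨L, hL⟩
      obtain ⟨B, hB⟩ := hbdd g hgC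
      have hg := hL.continuous
      have h1 : ∫ x, g x ∂(μ₁ : Measure X) = ∫ x, averageOp p f g x ∂(μ : Measure X) :=
        integral_bind_eq_integral_averageOp hp0 hκ hg hB _
      have h2 := hμint (continuous_averageOp hf hp hg) (abs_averageOp_le hp0 hpsum hB)
      have h3 : Tendsto (fun k => (averageOp p f)^[k] (averageOp p f g) x₀ -
          (averageOp p f)^[k] g x₀) atTop (𝓝 0) := by
        have : Tendsto (fun k => ∑ j, p j x₀ * ((averageOp p f)^[k] g (f j x₀) -
            (averageOp p f)^[k] g x₀)) atTop (𝓝 (∑ j, p j x₀ * 0)) :=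
          tendsto_finsetSum _ fun j _ => (hlim g L B hL hB _ _).const_mul _
        simp only [mul_zero, Finset.sum_const_zero] at this
        refine this.congr fun k => ?_
        rw [← Function.iterate_succ_apply, Function.iterate_succ_apply']
        simp only [averageOp, mul_sub, Finset.sum_sub_distrib, ← Finset.sum_mul, hpsum, one_mul]
      have h4 : ∫ x, averageOp p f g x ∂(μ : Measure X) - ∫ x, g x ∂(μ : Measure X) = 0 :=
        tendsto_nhds_unique (h2.sub (hμint hg hB)) (h3.mono_left hU)
      rw [h1, sub_eq_zero.1 h4]
      exact tendsto_const_nhds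
    have hμ₁ : μ₁ = μ := tendsto_nhds_unique tendsto_const_nhds h
    exact congrArg ProbabilityMeasure.toMeasure hμ₁
  have hattr : ∀ ν : Measure X, IsProbabilityMeasure ν →
      ∀ νiter : ℕ → Measure X, νiter 0 = ν → (∀ k, νiter (k + 1) = (νiter k).bind κ) →
      ∀ g : BoundedContinuousFunction X ℝ,
        Tendsto (fun k => ∫ x, g x ∂(νiter k)) atTop (𝓝 (∫ x, g x ∂(μ : Measure X))) := by
    rintro _ hν ν rfl hsucc
    have hνP := isProbabilityMeasure_of_succ_eq_bind hν hsucc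
    let νP : ℕ → ProbabilityMeasure X := fun k => ⟨ν k, hνP k⟩
    have h : Tendsto νP atTop (𝓝 μ) := by
      rw [tendsto_iff_forall_lipschitz_integral_tendsto]
      rintro g hgC ⟨L, hL⟩
      obtain ⟨B, hB⟩ := hbdd g hgC
      have hg := hL.continuous
      have hdiff := fun (ν : Measure X) (_ : IsProbabilityMeasure ν) =>
        tendsto_integral_averageOp_iterate_sub hf hp hp0 hpsum hg hB (hlim g L B hL hB) ν x₀
      have h1 := (hdiff (ν 0) hν).sub (hdiff μ inferInstance)
      have h2 : ∀ k, ∫ x, (averageOp p f)^[k] g x ∂(μ : Measure X) = ∫ x, g x ∂(μ : Measure X) :=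
        fun k => (integral_eq_integral_averageOp_iterate hf hp hp0 hpsum hκ
          (ν := fun _ => (μ : Measure X)) inferInstance (fun _ => hinv.symm) k hg hB).symm
      rw [sub_zero] at h1
      refine tendsto_sub_nhds_zero_iff.1 (h1.congr fun k => ?_)
      rw [h2, sub_sub_sub_cancel_right,
        ← integral_eq_integral_averageOp_iterate hf hp hp0 hpsum hκ hν hsucc k hg hB]
      rfl
    exact ProbabilityMeasure.tendsto_iff_forall_integral_tendsto.1 h
  refine ⟨μ, inferInstance, hinv, fun μ' hμ'P hμ'inv => ?_, hattr⟩
  refine ext_of_forall_integral_eq_of_IsFiniteMeasure fun g => ?_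
  exact tendsto_nhds_unique tendsto_const_nhds
    (hattr μ' hμ'P (fun _ => μ') rfl (fun _ => hμ'inv.symm) g)

/-- A nonnegative number bounded by `M` and by `L * d` is bounded by `(M + L) * d ^ q`,
for `0 ≤ q ≤ 1`. -/
lemma le_add_mul_rpow {u M L d q : ℝ} (hM : 0 ≤ M) (hL : 0 ≤ L) (hd : 0 ≤ d) (hq0 : 0 < q)
    (hq1 : q ≤ 1) (huM : u ≤ M) (huL : u ≤ L * d) : u ≤ (M + L) * d ^ q := by
  have hdq : 0 ≤ d ^ q := Real.rpow_nonneg hd q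
  rcases le_total d 1 with h | h
  · have : d ≤ d ^ q := by
      simpa using Real.rpow_le_rpow_of_exponent_ge_of_imp hd h hq1 (fun _ h' => absurd h' one_ne_zero)
    nlinarith [mul_le_mul_of_nonneg_left this hL, mul_nonneg hM hdq]
  · have : 1 ≤ d ^ q := Real.one_le_rpow h hq0.le
    nlinarith [mul_le_mul_of_nonneg_left this hM, mul_nonneg hL hdq]


/-- **Average contractivity theorem of Barnsley–Demko–Elton–Geronimo** (Theorem 1 in the
paper). Let `Σ` be a closed subset of `ℝⁿ`, `f₁, …, f_J : Σ → Σ` globally Lipschitz maps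
and `p₁, …, p_J` globally Lipschitz probability functions bounded below by `η > 0`.
If for all `x ≠ y` the average contractivity condition
`Π_j dist(f_j x, f_j y) ^ (p_j x) ≤ e^{-δ} * dist(x, y)` holds (the multiplicative form of
`Σ_j p_j(x) log(dist(f_j x, f_j y)/dist(x,y)) < -δ`), then the Markov kernel
`κ(x) = Σ_j p_j(x) • δ_{f_j(x)}` admits an attractive — hence unique — invariant
probability measure. -/
theorem barnsley_average_contractive_IFS_attractive_invariant_measure
    (n : ℕ) (s : Set (EuclideanSpace ℝ (Fin n))) (hs : IsClosed s) (hne : s.Nonempty)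
    (J : ℕ) (hJ : 1 ≤ J)
    (f : Fin J → s → s)
    (hflip : ∀ j, ∃ K : NNReal, LipschitzWith K (f j))
    (p : Fin J → s → ℝ) (η : ℝ) (hη : 0 < η)
    (hplip : ∀ j, ∃ K : NNReal, LipschitzWith K (p j))
    (hp01 : ∀ j x, p j x ∈ Set.Icc (0 : ℝ) 1)
    (hpsum : ∀ x, ∑ j, p j x = 1)
    (hpη : ∀ j x, η ≤ p j x)
    (δ : ℝ) (hδ : 0 < δ)
    (havg : ∀ x y : s, x ≠ y →
      ∏ j, dist (f j x) (f j y) ^ p j x ≤ Real.exp (-δ) * dist x y)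
    (κ : Kernel s s)
    (hκ : ∀ x, κ x = ∑ j, ENNReal.ofReal (p j x) • Measure.dirac (f j x)) :
    ∃ μ : Measure s, IsProbabilityMeasure μ ∧ Kernel.Invariant κ μ ∧
      (∀ μ' : Measure s, IsProbabilityMeasure μ' → Kernel.Invariant κ μ' → μ' = μ) ∧
      (∀ ν : Measure s, IsProbabilityMeasure ν →
        ∀ νiter : ℕ → Measure s, νiter 0 = ν →
          (∀ k, νiter (k + 1) = (νiter k).bind κ) →
          ∀ g : BoundedContinuousFunction s ℝ,
            Tendsto (fun k => ∫ x, g x ∂(νiter k)) atTop (𝓝 (∫ x, g x ∂μ))) := by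
  have hp0 : ∀ j x, 0 ≤ p j x := fun j x => (hp01 j x).1
  have : Nonempty s := hne.to_subtype
  have : Nonempty (Fin J) := ⟨⟨0, hJ⟩⟩
  have : ProperSpace s :=
    ⟨fun x r => hs.isClosedEmbedding_subtypeVal.isCompact_preimage (isCompact_closedBall x.1 r)⟩
  obtain ⟨x₀⟩ := ‹Nonempty s›
  obtain ⟨q, ρ, hq0, hq1, hρ0, hρ1, hctr⟩ :=
    exists_average_dist_rpow_le hflip hη hpsum hpη hδ havg
  have hρ : 0 < 1 - ρ := sub_pos.2 hρ1
  set e : s → s → ℝ := fun x y => dist x y ^ q with he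
  have he0 : ∀ x y, 0 ≤ e x y := fun x y => Real.rpow_nonneg dist_nonneg q
  have hetri : ∀ x y z, e x z ≤ e x y + e y z := fun x y z =>
    (Real.rpow_le_rpow dist_nonneg (dist_triangle x y z) hq0.le).trans
      (Real.rpow_add_le_add_rpow dist_nonneg dist_nonneg hq0.le hq1)
  choose L hL using hplip
  have hD : ∀ x y, ∑ j, |p j x - p j y| ≤ (∑ j, (1 + (L j : ℝ))) * e x y := fun x y => by
    rw [Finset.sum_mul]
    refine Finset.sum_le_sum fun j _ => le_add_mul_rpow zero_le_one (L j).coe_nonneg dist_nonneg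
      hq0 hq1 ?_ ((hL j).dist_le_mul x y)
    rw [abs_le]
    constructor <;> linarith [(hp01 j x).1, (hp01 j x).2, (hp01 j y).1, (hp01 j y).2]
  set C := ∑ j, e (f j x₀) x₀ with hC
  have hC0 : 0 ≤ C := Finset.sum_nonneg fun j _ => he0 _ _
  have hV : ∀ x, averageOp p f (fun x => e x x₀) x ≤ ρ * e x x₀ + (1 - ρ) * (C / (1 - ρ)) :=
    fun x => by
      rw [mul_div_cancel₀ _ hρ.ne']
      calc averageOp p f (fun x => e x x₀) x
          ≤ ∑ j, (p j x * e (f j x) (f j x₀) + e (f j x₀) x₀) :=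
            Finset.sum_le_sum fun j _ => by
              nlinarith [mul_le_mul_of_nonneg_left (hetri (f j x) (f j x₀) x₀) (hp0 j x),
                mul_le_mul_of_nonneg_right (hp01 j x).2 (he0 (f j x₀) x₀)]
        _ ≤ ρ * e x x₀ + C := by
            rw [Finset.sum_add_distrib]
            exact add_le_add_left (hctr x x₀) _
  have hVc : Continuous fun x => e x x₀ :=
    (continuous_id.dist continuous_const).rpow_const fun _ => Or.inr hq0.le
  have hK : 0 ≤ C / (1 - ρ) := by positivity
  refine exists_attractive_invariant_measure (fun j => (hflip j).choose_spec.continuous)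
    (fun j => (hL j).continuous) hp0 hpsum hκ hρ0 hρ1 hK hVc (fun x => he0 x x₀)
    (fun R => ?_) hV (fun g M B hM hB => ?_)
  · refine (isCompact_closedBall x₀ (max R 0 ^ q⁻¹)).of_isClosed_subset
      (isClosed_le hVc continuous_const) fun x hx => ?_
    rw [Metric.mem_closedBall, Real.le_rpow_inv_iff_of_pos dist_nonneg (le_max_right _ _) hq0]
    exact le_max_of_le_left hx
  · have hB0 : 0 ≤ B := (abs_nonneg _).trans (hB x₀)
    refine tendsto_averageOp_iterate_sub hp0 hpsum hη hpη hρ0 hρ1 he0 hctr (by positivity) hD hK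
      (fun x => he0 x x₀) hV (fun x y => ?_) (A := B + B + M) (by positivity) hB (fun x y => ?_)
    · simpa only [he, dist_comm y x₀] using hetri x x₀ y
    · exact le_add_mul_rpow (by positivity) M.coe_nonneg dist_nonneg hq0 hq1
        ((abs_sub _ _).trans (add_le_add (hB x) (hB y))) (hM.dist_le_mul x y)
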